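/- arXiv:2602.15301 — 5 statements merged into one kernel-verified Lean document; each statement's English description precedes it below -/
import Mathlib

section
/- Let k > 2 be a natural number and let a_1, ..., a_k, b be real numbers such that (a_1 + a_2 + ... + a_k)^2 = (k - 1)(a_1^2 + a_2^2 + ... + a_k^2 + b). Then 2*a_1*a_2 ≥ b. -/
/-- Chen's algebraic lemma (inequality part): if `k > 2` and
`(a_1 + ... + a_k)^2 = (k-1)(a_1^2 + ... + a_k^2 + b)`, then `2 a_1 a_2 ≥ b`.
Here the numbers `a_1, ..., a_k` are represented as `a 0, ..., a (k-1)`. -/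
theorem chen_lemma_inequality (k : ℕ) (hk : 2 < k) (a : ℕ → ℝ) (b : ℝ)
    (h : (∑ i ∈ Finset.range k, a i) ^ 2
        = ((k : ℝ) - 1) * ((∑ i ∈ Finset.range k, (a i) ^ 2) + b)) :
    2 * a 0 * a 1 ≥ b := by
  obtain ⟨m, rfl⟩ : ∃ m, k = m + 2 := ⟨k - 2, by omega⟩
  have cs := sq_sum_le_card_mul_sum_sq (s := Finset.range (m + 1))
    (f := fun i => if i = 0 then a 0 + a 1 else a (i + 1))
  rw [Finset.sum_range_succ', Finset.sum_range_succ'] at cs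
  rw [Finset.sum_range_succ', Finset.sum_range_succ', Finset.sum_range_succ',
    Finset.sum_range_succ'] at h
  simp only [Nat.add_eq_zero_iff, one_ne_zero, and_false, if_false, if_true,
    Finset.card_range, zero_add] at cs h
  push_cast at cs h
  have hm : (0 : ℝ) < (m : ℝ) + 1 := by positivity
  rw [add_assoc, add_comm (a 1) (a 0)] at h
  rw [h, show (m : ℝ) + 2 - 1 = m + 1 by ring] at cs
  have := le_of_mul_le_mul_left cs hm
  nlinarith
end

section
/- Let k > 2 be a natural number and let a_1, ..., a_k, b be real numbers such that (a_1 + a_2 + ... + a_k)^2 = (k - 1)(a_1^2 + a_2^2 + ... + a_k^2 + b). Then 2*a_1*a_2 = b if and only if a_1 + a_2 = a_3 = a_4 = ... = a_k. -/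
/-- Chen's algebraic lemma (equality part): if `k > 2` and
`(a_1 + ... + a_k)^2 = (k-1)(a_1^2 + ... + a_k^2 + b)`, then `2 a_1 a_2 = b`
if and only if `a_1 + a_2 = a_3 = ... = a_k`.
Here the numbers `a_1, ..., a_k` are represented as `a 0, ..., a (k-1)`. -/
theorem chen_lemma_equality (k : ℕ) (hk : 2 < k) (a : ℕ → ℝ) (b : ℝ)
    (h : (∑ i ∈ Finset.range k, a i) ^ 2
        = ((k : ℝ) - 1) * ((∑ i ∈ Finset.range k, (a i) ^ 2) + b)) :
    2 * a 0 * a 1 = b ↔ ∀ i, 2 ≤ i → i < k → a 0 + a 1 = a i := by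
  obtain ⟨m, rfl⟩ : ∃ m, k = m + 2 := ⟨k - 2, by omega⟩
  rw [Finset.sum_range_succ', Finset.sum_range_succ', Finset.sum_range_succ',
    Finset.sum_range_succ'] at h
  simp only [zero_add, add_assoc, one_add_one_eq_two] at h
  push_cast at h
  have hm : (0 : ℝ) < (m : ℝ) + 1 := by positivity
  constructor
  · intro hb
    obtain ⟨μ, hμ⟩ : ∃ μ : ℝ, ((m : ℝ) + 1) * μ
        = a 0 + a 1 + ∑ i ∈ Finset.range m, a (i + 2) :=
      ⟨(a 0 + a 1 + ∑ i ∈ Finset.range m, a (i + 2)) / ((m : ℝ) + 1), by field_simp⟩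
    have key : ∑ i ∈ Finset.range m, (a (i + 2) - μ) ^ 2
        = ∑ i ∈ Finset.range m, a (i + 2) ^ 2
          - 2 * μ * ∑ i ∈ Finset.range m, a (i + 2) + m * μ ^ 2 := by
      have : ∀ i, (a (i + 2) - μ) ^ 2 = a (i + 2) ^ 2 - 2 * μ * a (i + 2) + μ ^ 2 := by
        intro i; ring
      simp [this, Finset.sum_add_distrib, Finset.sum_sub_distrib, ← Finset.mul_sum]
    generalize hT : ∑ i ∈ Finset.range m, a (i + 2) = T at *
    generalize hU : ∑ i ∈ Finset.range m, a (i + 2) ^ 2 = U at *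
    have hT' : T = ((m : ℝ) + 1) * μ - a 0 - a 1 := by linarith
    have hq : ((m : ℝ) + 1) * μ ^ 2 = (a 0 + a 1) ^ 2 + U := by
      apply mul_left_cancel₀ hm.ne'
      rw [hT', ← hb] at h
      linear_combination h
    have hz : (a 0 + a 1 - μ) ^ 2 + ∑ i ∈ Finset.range m, (a (i + 2) - μ) ^ 2 = 0 := by
      rw [key, hT']
      linear_combination -hq
    have hs : 0 ≤ ∑ i ∈ Finset.range m, (a (i + 2) - μ) ^ 2 :=
      Finset.sum_nonneg fun i _ => sq_nonneg _
    have h1 : (a 0 + a 1 - μ) ^ 2 = 0 := by nlinarith [sq_nonneg (a 0 + a 1 - μ)]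
    have h2 : ∑ i ∈ Finset.range m, (a (i + 2) - μ) ^ 2 = 0 := by linarith
    rw [Finset.sum_eq_zero_iff_of_nonneg (fun i _ => sq_nonneg _)] at h2
    intro i hi hik
    obtain ⟨j, rfl⟩ : ∃ j, i = j + 2 := ⟨i - 2, by omega⟩
    have h3 := h2 j (Finset.mem_range.2 (by omega))
    have h4 := pow_eq_zero_iff (two_ne_zero) |>.1 h1
    have h5 := pow_eq_zero_iff (two_ne_zero) |>.1 h3
    linarith
  · intro hi
    have e1 : ∑ i ∈ Finset.range m, a (i + 2) = m * (a 0 + a 1) := by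
      rw [Finset.sum_congr rfl (g := fun _ => a 0 + a 1)]
      · simp [mul_add]
      · intro i h'
        exact (hi (i + 2) (by omega) (by have := Finset.mem_range.1 h'; omega)).symm
    have e2 : ∑ i ∈ Finset.range m, a (i + 2) ^ 2 = m * (a 0 + a 1) ^ 2 := by
      rw [Finset.sum_congr rfl (g := fun _ => (a 0 + a 1) ^ 2)]
      · simp
      · intro i h'
        rw [hi (i + 2) (by omega) (by have := Finset.mem_range.1 h'; omega)]
    rw [e1, e2] at h
    apply mul_left_cancel₀ hm.ne'
    linear_combination h
end

section
/- Let r > 2 and s ≥ 1 be natural numbers, let T^ℓ_{ij} (for 1 ≤ i, j ≤ r and 1 ≤ ℓ ≤ s) be real numbers with T^ℓ_{ij} = T^ℓ_{ji} for all i, j, ℓ, and let ε be a real number. Suppose (∑_{i=1}^r T^1_{ii})^2 = (r - 1) * ( ∑_{i=1}^r (T^1_{ii})^2 + ∑_{i ≠ j} (T^1_{ij})^2 + ∑_{ℓ=2}^s ∑_{i,j=1}^r (T^ℓ_{ij})^2 + ε ). Then T^1_{11} * T^1_{22} − (T^1_{12})^2 + ∑_{ℓ=2}^s ( T^ℓ_{11}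 * T^ℓ_{22} − (T^ℓ_{12})^2 ) ≥ ε / 2. -/
/-- Algebraic core of Theorem 1 of the paper: with `T ℓ i j` representing the
component `T^{ℓ+1}_{(i+1)(j+1)}` (0-indexed) of the horizontal O'Neill tensor,
symmetric in `i, j`, if
`(∑_i T^1_{ii})^2 = (r-1)(∑_i (T^1_{ii})^2 + ∑_{i≠j} (T^1_{ij})^2
  + ∑_{ℓ=2}^s ∑_{i,j} (T^ℓ_{ij})^2 + ε)`,
then `T^1_{11} T^1_{22} - (T^1_{12})^2 + ∑_{ℓ=2}^s (T^ℓ_{11} T^ℓ_{22} - (T^ℓ_{12})^2) ≥ ε/2`. -/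
theorem chen_submersion_sectional_curvature_bound (r s : ℕ) (hr : 2 < r) (hs : 1 ≤ s)
    (T : ℕ → ℕ → ℕ → ℝ) (hsymm : ∀ ℓ i j, T ℓ i j = T ℓ j i) (ε : ℝ)
    (h : (∑ i ∈ Finset.range r, T 0 i i) ^ 2
        = ((r : ℝ) - 1) * ((∑ i ∈ Finset.range r, (T 0 i i) ^ 2)
          + (∑ i ∈ Finset.range r, ∑ j ∈ (Finset.range r).erase i, (T 0 i j) ^ 2)
          + (∑ ℓ ∈ Finset.Ico 1 s, ∑ i ∈ Finset.range r, ∑ j ∈ Finset.range r,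
              (T ℓ i j) ^ 2)
          + ε)) :
    T 0 0 0 * T 0 1 1 - (T 0 0 1) ^ 2
      + ∑ ℓ ∈ Finset.Ico 1 s, (T ℓ 0 0 * T ℓ 1 1 - (T ℓ 0 1) ^ 2)
      ≥ ε / 2 := by
  obtain ⟨n, rfl⟩ : ∃ n, r = n + 2 := ⟨r - 2, by omega⟩
  have hB : 2 * (T 0 0 1) ^ 2 ≤
      ∑ i ∈ Finset.range (n + 2), ∑ j ∈ (Finset.range (n + 2)).erase i, (T 0 i j) ^ 2 := by
    have h0 : (T 0 0 1) ^ 2 ≤ ∑ j ∈ (Finset.range (n + 2)).erase 0, (T 0 0 j) ^ 2 :=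
      Finset.single_le_sum (f := fun j => (T 0 0 j) ^ 2) (fun j _ => sq_nonneg _) (by simp)
    have h1 : (T 0 1 0) ^ 2 ≤ ∑ j ∈ (Finset.range (n + 2)).erase 1, (T 0 1 j) ^ 2 :=
      Finset.single_le_sum (f := fun j => (T 0 1 j) ^ 2) (fun j _ => sq_nonneg _) (by simp)
    rw [hsymm 0 1 0] at h1
    rw [Finset.sum_range_succ', Finset.sum_range_succ']
    have h2 : 0 ≤ ∑ k ∈ Finset.range n,
        ∑ j ∈ (Finset.range (n + 2)).erase (k + 1 + 1), (T 0 (k + 1 + 1) j) ^ 2 :=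
      Finset.sum_nonneg fun i _ => Finset.sum_nonneg fun j _ => sq_nonneg _
    simp only [zero_add] at *
    linarith
  have hC : ∀ ℓ, -(T ℓ 0 0 * T ℓ 1 1 - (T ℓ 0 1) ^ 2) * 2 ≤
      ∑ i ∈ Finset.range (n + 2), ∑ j ∈ Finset.range (n + 2), (T ℓ i j) ^ 2 := by
    intro ℓ
    have hrow : ∀ i, (T ℓ i 0) ^ 2 + (T ℓ i 1) ^ 2 ≤
        ∑ j ∈ Finset.range (n + 2), (T ℓ i j) ^ 2 := by
      intro i
      rw [Finset.sum_range_succ', Finset.sum_range_succ']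
      have h2 : 0 ≤ ∑ k ∈ Finset.range n, (T ℓ i (k + 1 + 1)) ^ 2 :=
        Finset.sum_nonneg fun j _ => sq_nonneg _
      simp only [zero_add] at *
      linarith
    have h0 := hrow 0
    have h1 := hrow 1
    rw [Finset.sum_range_succ', Finset.sum_range_succ']
    have h2 : 0 ≤ ∑ k ∈ Finset.range n,
        ∑ j ∈ Finset.range (n + 2), (T ℓ (k + 1 + 1) j) ^ 2 :=
      Finset.sum_nonneg fun i _ => Finset.sum_nonneg fun j _ => sq_nonneg _
    rw [hsymm ℓ 1 0] at h1
    simp only [zero_add] at *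
    nlinarith [sq_nonneg (T ℓ 0 0 + T ℓ 1 1)]
  have hC' := Finset.sum_le_sum (s := Finset.Ico 1 s) fun ℓ _ => hC ℓ
  rw [← Finset.sum_mul, Finset.sum_neg_distrib] at hC'
  have hCS := sq_sum_le_card_mul_sum_sq (s := Finset.range (n + 1))
    (f := fun k => if k = 0 then T 0 0 0 + T 0 1 1 else T 0 (k + 1) (k + 1))
  rw [Finset.sum_range_succ', Finset.sum_range_succ'] at hCS
  simp only [Nat.add_eq_zero_iff, one_ne_zero, and_false, if_false, if_true,
    Finset.card_range] at hCS
  rw [Finset.sum_range_succ' (fun i => T 0 i i), Finset.sum_range_succ' (fun i => T 0 (i+1) (i+1)),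
    Finset.sum_range_succ' (fun i => (T 0 i i) ^ 2),
    Finset.sum_range_succ' (fun i => (T 0 (i+1) (i+1)) ^ 2)] at h
  simp only [zero_add] at h
  push_cast at h hCS
  rw [add_comm (T 0 0 0), ← add_assoc, h] at hCS
  have hn : (0 : ℝ) < (n : ℝ) + 1 := by positivity
  rw [show (n : ℝ) + 2 - 1 = n + 1 by ring] at hCS
  have := le_of_mul_le_mul_left hCS hn
  nlinarith
end

section
/- Let r > 2 and s ≥ 1 be natural numbers, let T^ℓ_{ij} (for 1 ≤ i, j ≤ r and 1 ≤ ℓ ≤ s) be real numbers with T^ℓ_{ij} = T^ℓ_{ji} for all i, j, ℓ, and let ε be a real number. Suppose (∑_{i=1}^r T^1_{ii})^2 = (r - 1) * ( ∑_{i=1}^r (T^1_{ii})^2 + ∑_{i ≠ j} (T^1_{ij})^2 + ∑_{ℓ=2}^s ∑_{i,j=1}^r (T^ℓ_{ij})^2 + ε ). Then equality T^1_{11} * T^1_{22} − (T^1_{12})^2 + ∑_{ℓ=2}^s ( T^ℓ_{11} * T^ℓ_{22} − (T^ℓ_{12})^2 ) = ε / 2 holds if and only if all of the following conditions hold: (i)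 T^ℓ_{1j} = T^ℓ_{2j} = 0 for all j > 2 and all 1 ≤ ℓ ≤ s; (ii) T^1_{ij} = 0 for all i ≠ j with i, j > 2; (iii) T^ℓ_{ij} = 0 for all i, j > 2 and all 2 ≤ ℓ ≤ s; (iv) T^ℓ_{11} + T^ℓ_{22} = 0 for all 2 ≤ ℓ ≤ s; and (v) T^1_{11} + T^1_{22} = T^1_{33} = T^1_{44} = ... = T^1_{rr}. -/
/-- Split a symmetric double sum of squares into the upper-left block and the rest. -/
lemma chen_split (n : ℕ) (M : ℕ → ℕ → ℝ) (hM : ∀ i j, M i j = M j i) :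
    (∑ i ∈ Finset.range (n + 2), ∑ j ∈ Finset.range (n + 2), (M i j) ^ 2)
      = (M 0 0) ^ 2 + (M 1 1) ^ 2 + 2 * (M 0 1) ^ 2
        + (2 * (∑ j ∈ Finset.range n, ((M 0 (j + 2)) ^ 2 + (M 1 (j + 2)) ^ 2))
        + ∑ i ∈ Finset.range n, ∑ j ∈ Finset.range n, (M (i + 2) (j + 2)) ^ 2) := by
  simp only [Finset.sum_range_succ', Finset.sum_add_distrib, Nat.add_assoc, Nat.reduceAdd,
    zero_add]
  rw [hM 1 0, Finset.sum_congr rfl (fun i _ => by rw [hM (i + 2) 0] :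
      ∀ i ∈ Finset.range n, (M (i + 2) 0) ^ 2 = (M 0 (i + 2)) ^ 2),
    Finset.sum_congr rfl (fun i _ => by rw [hM (i + 2) 1] :
      ∀ i ∈ Finset.range n, (M (i + 2) 1) ^ 2 = (M 1 (i + 2)) ^ 2)]
  ring

/-- The remaining part of the split vanishes iff all its entries do. -/
lemma chen_rest_nonneg (n : ℕ) (M : ℕ → ℕ → ℝ) :
    0 ≤ 2 * (∑ j ∈ Finset.range n, ((M 0 (j + 2)) ^ 2 + (M 1 (j + 2)) ^ 2))
        + ∑ i ∈ Finset.range n, ∑ j ∈ Finset.range n, (M (i + 2) (j + 2)) ^ 2 := by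
  positivity

lemma chen_rest_zero (n : ℕ) (M : ℕ → ℕ → ℝ) :
    2 * (∑ j ∈ Finset.range n, ((M 0 (j + 2)) ^ 2 + (M 1 (j + 2)) ^ 2))
        + ∑ i ∈ Finset.range n, ∑ j ∈ Finset.range n, (M (i + 2) (j + 2)) ^ 2 = 0 ↔
    (∀ j, 2 ≤ j → j < n + 2 → M 0 j = 0 ∧ M 1 j = 0) ∧
    (∀ i j, 2 ≤ i → i < n + 2 → 2 ≤ j → j < n + 2 → M i j = 0) := by
  rw [add_eq_zero_iff_of_nonneg (by positivity) (by positivity), mul_eq_zero_iff_left two_ne_zero,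
    Finset.sum_eq_zero_iff_of_nonneg (fun _ _ => by positivity),
    Finset.sum_eq_zero_iff_of_nonneg (fun _ _ => by positivity)]
  constructor
  · rintro ⟨h1, h2⟩
    constructor
    · intro j hj hj'
      obtain ⟨k, rfl⟩ := Nat.exists_eq_add_of_le' hj
      have := h1 k (Finset.mem_range.2 (by omega))
      constructor <;> nlinarith [sq_nonneg (M 0 (k + 2)), sq_nonneg (M 1 (k + 2))]
    · intro i j hi hi' hj hj'
      obtain ⟨k, rfl⟩ := Nat.exists_eq_add_of_le' hj
      obtain ⟨l, rfl⟩ := Nat.exists_eq_add_of_le' hi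
      have := h2 l (Finset.mem_range.2 (by omega))
      rw [Finset.sum_eq_zero_iff_of_nonneg (fun _ _ => by positivity)] at this
      exact pow_eq_zero_iff two_ne_zero |>.1 (this k (Finset.mem_range.2 (by omega)))
  · rintro ⟨h1, h2⟩
    constructor
    · intro j hj
      have hj := Finset.mem_range.1 hj
      have := h1 (j + 2) (by omega) (by omega)
      simp [this.1, this.2]
    · intro i hi
      have hi := Finset.mem_range.1 hi
      refine Finset.sum_eq_zero fun j hj => ?_
      have hj := Finset.mem_range.1 hj
      simp [h2 (i + 2) (j + 2) (by omega) (by omega) (by omega) (by omega)]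

/-- Variance identity. -/
lemma chen_var (n : ℕ) (u m : ℝ) (d : ℕ → ℝ)
    (hm : ((n : ℝ) + 1) * m = u + ∑ i ∈ Finset.range n, d i) :
    (u - m) ^ 2 + ∑ i ∈ Finset.range n, (d i - m) ^ 2
      = u ^ 2 + ∑ i ∈ Finset.range n, (d i) ^ 2 - ((n : ℝ) + 1) * m ^ 2 := by
  have : ∑ i ∈ Finset.range n, (d i - m) ^ 2
      = ∑ i ∈ Finset.range n, (d i) ^ 2 - 2 * m * ∑ i ∈ Finset.range n, d i + n * m ^ 2 := by
    simp only [sub_sq, Finset.sum_add_distrib, Finset.sum_sub_distrib, Finset.sum_const,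
      Finset.card_range, nsmul_eq_mul, Finset.mul_sum]
    congr 2
    exact Finset.sum_congr rfl fun i _ => by ring
  rw [this]
  linear_combination 2 * m * hm

/-- Equality case of Chen's first inequality for Riemannian submersions
(Theorem 1 of the paper) in purely algebraic form: with `T ℓ i j` representing
the component `T^{ℓ+1}_{(i+1)(j+1)}` (0-indexed) of the horizontal O'Neill tensor,
symmetric in `i, j`, and the hypothesis
`(∑_i T^1_{ii})^2 = (r-1)(∑_i (T^1_{ii})^2 + ∑_{i≠j} (T^1_{ij})^2
  + ∑_{ℓ=2}^s ∑_{i,j} (T^ℓ_{ij})^2 + ε)`,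
equality `T^1_{11} T^1_{22} - (T^1_{12})^2 + ∑_{ℓ=2}^s (T^ℓ_{11} T^ℓ_{22} - (T^ℓ_{12})^2) = ε/2`
holds iff conditions (i)–(v) hold. -/
theorem chen_submersion_equality_case (r s : ℕ) (hr : 2 < r) (hs : 1 ≤ s)
    (T : ℕ → ℕ → ℕ → ℝ) (hsymm : ∀ ℓ i j, T ℓ i j = T ℓ j i) (ε : ℝ)
    (h : (∑ i ∈ Finset.range r, T 0 i i) ^ 2
        = ((r : ℝ) - 1) * ((∑ i ∈ Finset.range r, (T 0 i i) ^ 2)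
          + (∑ i ∈ Finset.range r, ∑ j ∈ (Finset.range r).erase i, (T 0 i j) ^ 2)
          + (∑ ℓ ∈ Finset.Ico 1 s, ∑ i ∈ Finset.range r, ∑ j ∈ Finset.range r,
              (T ℓ i j) ^ 2)
          + ε)) :
    (T 0 0 0 * T 0 1 1 - (T 0 0 1) ^ 2
        + ∑ ℓ ∈ Finset.Ico 1 s, (T ℓ 0 0 * T ℓ 1 1 - (T ℓ 0 1) ^ 2)
        = ε / 2)
    ↔ ((∀ ℓ, ℓ < s → ∀ j, 2 ≤ j → j < r → T ℓ 0 j = 0 ∧ T ℓ 1 j = 0)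
      ∧ (∀ i j, 2 ≤ i → i < r → 2 ≤ j → j < r → i ≠ j → T 0 i j = 0)
      ∧ (∀ ℓ, 1 ≤ ℓ → ℓ < s → ∀ i j, 2 ≤ i → i < r → 2 ≤ j → j < r → T ℓ i j = 0)
      ∧ (∀ ℓ, 1 ≤ ℓ → ℓ < s → T ℓ 0 0 + T ℓ 1 1 = 0)
      ∧ (∀ i, 2 ≤ i → i < r → T 0 0 0 + T 0 1 1 = T 0 i i)) := by
  obtain ⟨n, rfl⟩ := Nat.exists_eq_add_of_le' hr.le
  set N : ℕ → ℕ → ℝ := fun i j => if i = j then 0 else T 0 i j with hN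
  have hNs : ∀ i j, N i j = N j i := by
    intro i j
    simp only [hN, hsymm 0 i j, eq_comm]
  set R : (ℕ → ℕ → ℝ) → ℝ := fun M =>
    2 * (∑ j ∈ Finset.range n, ((M 0 (j + 2)) ^ 2 + (M 1 (j + 2)) ^ 2))
        + ∑ i ∈ Finset.range n, ∑ j ∈ Finset.range n, (M (i + 2) (j + 2)) ^ 2 with hR
  have hR0 : ∀ M, 0 ≤ R M := fun M => chen_rest_nonneg n M
  have hRz : ∀ M, R M = 0 ↔ _ := fun M => chen_rest_zero n M
  have hoff : (∑ i ∈ Finset.range (n + 2), ∑ j ∈ (Finset.range (n + 2)).erase i, (T 0 i j) ^ 2)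
      = 2 * (T 0 0 1) ^ 2 + R N := by
    have h1 : (∑ i ∈ Finset.range (n + 2), ∑ j ∈ (Finset.range (n + 2)).erase i, (T 0 i j) ^ 2)
        = ∑ i ∈ Finset.range (n + 2), ∑ j ∈ Finset.range (n + 2), (N i j) ^ 2 := by
      refine Finset.sum_congr rfl fun i hi => ?_
      rw [← Finset.add_sum_erase _ _ hi]
      have : (N i i) ^ 2 = 0 := by simp [hN]
      rw [this, zero_add]
      refine Finset.sum_congr rfl fun j hj => ?_
      have hne := (Finset.mem_erase.1 hj).1
      simp [hN, hne.symm]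
    rw [h1, chen_split n N hNs]
    have e1 : N 0 0 = 0 := by simp [hN]
    have e2 : N 1 1 = 0 := by simp [hN]
    have e3 : N 0 1 = T 0 0 1 := by simp [hN]
    rw [e1, e2, e3]
    simp only [hR]
    ring
  have hW : (∑ ℓ ∈ Finset.Ico 1 s, ∑ i ∈ Finset.range (n + 2), ∑ j ∈ Finset.range (n + 2),
              (T ℓ i j) ^ 2) + 2 * ∑ ℓ ∈ Finset.Ico 1 s, (T ℓ 0 0 * T ℓ 1 1 - (T ℓ 0 1) ^ 2)
      = ∑ ℓ ∈ Finset.Ico 1 s, ((T ℓ 0 0 + T ℓ 1 1) ^ 2 + R (T ℓ)) := by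
    rw [Finset.mul_sum, ← Finset.sum_add_distrib]
    refine Finset.sum_congr rfl fun ℓ _ => ?_
    rw [chen_split n (T ℓ) (hsymm ℓ)]
    simp only [hR]
    ring
  have hn : (n : ℝ) + 1 ≠ 0 := by positivity
  obtain ⟨m, hm⟩ : ∃ m : ℝ, ((n : ℝ) + 1) * m
      = (T 0 0 0 + T 0 1 1) + ∑ i ∈ Finset.range n, T 0 (i + 2) (i + 2) :=
    ⟨_, mul_div_cancel₀ _ hn⟩
  have hv := chen_var n _ m (fun i => T 0 (i + 2) (i + 2)) hm
  have hd1 : ∑ i ∈ Finset.range (n + 2), T 0 i i = ((n : ℝ) + 1) * m := by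
    rw [hm]
    simp only [Finset.sum_range_succ', Nat.add_assoc, Nat.reduceAdd, zero_add]
    ring
  have hd2 : ∑ i ∈ Finset.range (n + 2), (T 0 i i) ^ 2
      = (T 0 0 0) ^ 2 + (T 0 1 1) ^ 2 + ∑ i ∈ Finset.range n, (T 0 (i + 2) (i + 2)) ^ 2 := by
    simp only [Finset.sum_range_succ', Nat.add_assoc, Nat.reduceAdd, zero_add]
    ring
  rw [hd1, hd2, hoff] at h
  have hc : ((n + 2 : ℕ) : ℝ) - 1 = (n : ℝ) + 1 := by push_cast; ring
  rw [hc, mul_pow, sq ((n : ℝ) + 1), mul_assoc] at h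
  have h := mul_left_cancel₀ hn h
  set P := (T 0 0 0 + T 0 1 1 - m) ^ 2 + ∑ i ∈ Finset.range n, (T 0 (i + 2) (i + 2) - m) ^ 2
    with hP
  set W := ∑ ℓ ∈ Finset.Ico 1 s, ((T ℓ 0 0 + T ℓ 1 1) ^ 2 + R (T ℓ)) with hWd
  have hP0 : 0 ≤ P := by positivity
  have hW0 : 0 ≤ W := Finset.sum_nonneg fun ℓ _ => add_nonneg (sq_nonneg _) (hR0 _)
  have key : 2 * (T 0 0 0 * T 0 1 1 - (T 0 0 1) ^ 2
        + ∑ ℓ ∈ Finset.Ico 1 s, (T ℓ 0 0 * T ℓ 1 1 - (T ℓ 0 1) ^ 2)) - ε = P + R N + W := by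
    linear_combination hW - hv + h
  have step : (T 0 0 0 * T 0 1 1 - (T 0 0 1) ^ 2
        + ∑ ℓ ∈ Finset.Ico 1 s, (T ℓ 0 0 * T ℓ 1 1 - (T ℓ 0 1) ^ 2) = ε / 2)
      ↔ (P = 0 ∧ R N = 0 ∧ W = 0) := by
    have := hR0 N
    constructor
    · intro h'
      refine ⟨?_, ?_, ?_⟩ <;> linarith
    · rintro ⟨h1, h2, h3⟩
      linarith
  have hPz : P = 0 ↔ ∀ i, 2 ≤ i → i < n + 2 → T 0 0 0 + T 0 1 1 = T 0 i i := by
    rw [hP, add_eq_zero_iff_of_nonneg (by positivity) (by positivity),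
      Finset.sum_eq_zero_iff_of_nonneg (fun _ _ => by positivity)]
    constructor
    · rintro ⟨h1, h2⟩ i hi hi'
      obtain ⟨k, rfl⟩ := Nat.exists_eq_add_of_le' hi
      have a := pow_eq_zero_iff two_ne_zero |>.1 h1
      have b := pow_eq_zero_iff two_ne_zero |>.1 (h2 k (Finset.mem_range.2 (by omega)))
      linarith
    · intro h1
      have e : ∑ i ∈ Finset.range n, T 0 (i + 2) (i + 2) = n * (T 0 0 0 + T 0 1 1) := by
        rw [Finset.sum_congr rfl (fun i hi => (h1 (i + 2) (by omega)
          (by have := Finset.mem_range.1 hi; omega)).symm)]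
        simp [mul_add]
      have em : m = T 0 0 0 + T 0 1 1 := by
        apply mul_left_cancel₀ hn
        rw [hm, e]
        ring
      refine ⟨by rw [em]; ring, fun i hi => ?_⟩
      rw [em, ← h1 (i + 2) (by omega) (by have := Finset.mem_range.1 hi; omega)]
      ring
  have hWz : W = 0 ↔ ∀ ℓ, 1 ≤ ℓ → ℓ < s → T ℓ 0 0 + T ℓ 1 1 = 0 ∧ R (T ℓ) = 0 := by
    rw [hWd, Finset.sum_eq_zero_iff_of_nonneg
      (fun ℓ _ => add_nonneg (sq_nonneg _) (hR0 _))]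
    simp only [Finset.mem_Ico, and_imp]
    refine forall_congr' fun ℓ => forall_congr' fun _ => forall_congr' fun _ => ?_
    rw [add_eq_zero_iff_of_nonneg (sq_nonneg _) (hR0 _), pow_eq_zero_iff two_ne_zero]
  rw [step, hPz, hWz]
  simp only [hRz]
  have hN1 : ∀ i j, i ≠ j → N i j = T 0 i j := fun i j hij => by simp [hN, hij]
  have hN2 : ∀ i, N i i = 0 := fun i => by simp [hN]
  clear_value N
  constructor
  · rintro ⟨h5, ⟨a, b⟩, c⟩
    refine ⟨?_, ?_, ?_, ?_, h5⟩
    · intro ℓ hℓ j hj hj'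
      rcases Nat.eq_zero_or_pos ℓ with rfl | hpos
      · rw [← hN1 0 j (by omega), ← hN1 1 j (by omega)]
        exact a j hj hj'
      · exact (c ℓ hpos hℓ).2.1 j hj hj'
    · intro i j hi hi' hj hj' hij
      rw [← hN1 i j hij]
      exact b i j hi hi' hj hj'
    · intro ℓ h1 h2
      exact (c ℓ h1 h2).2.2
    · intro ℓ h1 h2
      exact (c ℓ h1 h2).1
  · rintro ⟨h1, h2, h3, h4, h5⟩
    refine ⟨h5, ⟨?_, ?_⟩, ?_⟩
    · intro j hj hj'
      rw [hN1 0 j (by omega), hN1 1 j (by omega)]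
      exact h1 0 (by omega) j hj hj'
    · intro i j hi hi' hj hj'
      by_cases hij : i = j
      · rw [hij, hN2]
      · rw [hN1 i j hij]
        exact h2 i j hi hi' hj hj' hij
    · intro ℓ hl hl'
      exact ⟨h4 ℓ hl hl', h1 ℓ hl', h3 ℓ hl hl'⟩
end

section
/- Let r > 2 and s ≥ 1 be natural numbers, and let T^ℓ_{ij} (for 1 ≤ i, j ≤ r and 1 ≤ ℓ ≤ s) be real numbers with T^ℓ_{ij} = T^ℓ_{ji} for all i, j, ℓ. For each ℓ set N_ℓ = ∑_{i=1}^r T^ℓ_{ii}, and assume N_ℓ = 0 for all 2 ≤ ℓ ≤ s. Then (1/2) * ( N_1^2 − ∑_{ℓ=1}^s ∑_{i,j=1}^r (T^ℓ_{ij})^2 ) − ∑_{ℓ=1}^s ( T^ℓ_{11} * T^ℓ_{22} − (T^ℓ_{12})^2 ) ≤ ((r − 2) / (2*(r − 1))) * N_1^2. -/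
/-- The inequality for a single horizontal direction. -/
theorem chen_single (m : ℕ) (A : ℕ → ℕ → ℝ) (hA : ∀ i j, A i j = A j i) :
    (∑ i ∈ Finset.range (m + 2), A i i) ^ 2 ≤ ((m : ℝ) + 1) *
      ((∑ i ∈ Finset.range (m + 2), ∑ j ∈ Finset.range (m + 2), (A i j) ^ 2)
        + 2 * (A 0 0 * A 1 1 - (A 0 1) ^ 2)) := by
  have h1 : (∑ i ∈ Finset.range m, (A (i + 2) (i + 2)) ^ 2) ≤
      ∑ i ∈ Finset.range m, ∑ j ∈ Finset.range (m + 2), (A (i + 2) j) ^ 2 := by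
    apply Finset.sum_le_sum
    intro i hi
    refine Finset.single_le_sum (f := fun j => (A (i + 2) j) ^ 2)
      (fun j _ => sq_nonneg _) ?_
    simpa using hi
  have h2 : ∀ k, (A k 0) ^ 2 + (A k 1) ^ 2 ≤ ∑ j ∈ Finset.range (m + 2), (A k j) ^ 2 := by
    intro k
    rw [Finset.sum_range_succ', Finset.sum_range_succ']
    have : 0 ≤ ∑ j ∈ Finset.range m, (A k (j + 1 + 1)) ^ 2 :=
      Finset.sum_nonneg (fun j _ => sq_nonneg _)
    simp only [zero_add]
    linarith
  have h3 := sq_sum_le_card_mul_sum_sq (s := Finset.range (m + 1))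
    (f := fun i => if i = 0 then A 0 0 + A 1 1 else A (i + 1) (i + 1))
  rw [Finset.sum_range_succ', Finset.sum_range_succ'] at h3
  simp only [Nat.add_eq_zero_iff, one_ne_zero, and_false, if_false, if_true,
    Finset.card_range, Nat.cast_add, Nat.cast_one] at h3
  have h4 : (∑ i ∈ Finset.range (m + 2), A i i) =
      (∑ i ∈ Finset.range m, A (i + 1 + 1) (i + 1 + 1)) + (A 0 0 + A 1 1) := by
    rw [Finset.sum_range_succ', Finset.sum_range_succ']
    simp only [zero_add]
    ring
  have h5 : (∑ i ∈ Finset.range (m + 2), ∑ j ∈ Finset.range (m + 2), (A i j) ^ 2) =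
      (∑ i ∈ Finset.range m, ∑ j ∈ Finset.range (m + 2), (A (i + 2) j) ^ 2)
      + (∑ j ∈ Finset.range (m + 2), (A 1 j) ^ 2)
      + (∑ j ∈ Finset.range (m + 2), (A 0 j) ^ 2) := by
    rw [Finset.sum_range_succ', Finset.sum_range_succ' _ m]
  rw [h4]
  refine h3.trans ?_
  refine mul_le_mul_of_nonneg_left ?_ (by positivity)
  rw [h5]
  have e0 := h2 0
  have e1 := h2 1
  rw [hA 1 0] at e1
  nlinarith

/-- Algebraic form of Chen's first inequality for Riemannian submersions along
vertical distributions (Theorem 1 of the paper): with `T ℓ i j` representing the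
component `T^{ℓ+1}_{(i+1)(j+1)}` (0-indexed) of the horizontal O'Neill tensor,
symmetric in `i, j`, `N ℓ = ∑_i T^ℓ_{ii}`, and assuming `N ℓ = 0` for all
`2 ≤ ℓ ≤ s`, we have
`(1/2)(N_1^2 - ∑_{ℓ,i,j} (T^ℓ_{ij})^2) - ∑_ℓ (T^ℓ_{11} T^ℓ_{22} - (T^ℓ_{12})^2)
  ≤ ((r-2)/(2(r-1))) N_1^2`. -/
theorem chen_first_inequality_submersion_algebraic (r s : ℕ) (hr : 2 < r) (hs : 1 ≤ s)
    (T : ℕ → ℕ → ℕ → ℝ) (hsymm : ∀ ℓ i j, T ℓ i j = T ℓ j i)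
    (N : ℕ → ℝ) (hN : ∀ ℓ, N ℓ = ∑ i ∈ Finset.range r, T ℓ i i)
    (hN0 : ∀ ℓ, 1 ≤ ℓ → ℓ < s → N ℓ = 0) :
    (1 / 2) * ((N 0) ^ 2
        - ∑ ℓ ∈ Finset.range s, ∑ i ∈ Finset.range r, ∑ j ∈ Finset.range r,
            (T ℓ i j) ^ 2)
      - ∑ ℓ ∈ Finset.range s, (T ℓ 0 0 * T ℓ 1 1 - (T ℓ 0 1) ^ 2)
      ≤ (((r : ℝ) - 2) / (2 * ((r : ℝ) - 1))) * (N 0) ^ 2 := by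
  obtain ⟨m, rfl⟩ : ∃ m, r = m + 2 := ⟨r - 2, by omega⟩
  have hm : (0 : ℝ) < (m : ℝ) + 1 := by positivity
  have key : ∑ ℓ ∈ Finset.range s, (N ℓ) ^ 2 ≤ ∑ ℓ ∈ Finset.range s, ((m : ℝ) + 1) *
      ((∑ i ∈ Finset.range (m + 2), ∑ j ∈ Finset.range (m + 2), (T ℓ i j) ^ 2)
        + 2 * (T ℓ 0 0 * T ℓ 1 1 - (T ℓ 0 1) ^ 2)) := by
    apply Finset.sum_le_sum
    intro ℓ _
    rw [hN ℓ]
    exact chen_single m (T ℓ) (hsymm ℓ)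
  have hsum : ∑ ℓ ∈ Finset.range s, (N ℓ) ^ 2 = (N 0) ^ 2 := by
    apply Finset.sum_eq_single_of_mem 0 (by simp; omega)
    intro ℓ hl h0
    rw [hN0 ℓ (by omega) (by simpa using hl)]
    simp
  rw [hsum, ← Finset.mul_sum, Finset.sum_add_distrib, ← Finset.mul_sum] at key
  have k2 := (div_le_iff₀' hm).2 key
  have e : (((m + 2 : ℕ) : ℝ) - 2) / (2 * (((m + 2 : ℕ) : ℝ) - 1)) * (N 0) ^ 2
      = (1 / 2) * ((N 0) ^ 2 - (N 0) ^ 2 / ((m : ℝ) + 1)) := by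
    have : ((m + 2 : ℕ) : ℝ) - 1 = m + 1 := by push_cast; ring
    rw [this]
    push_cast
    field_simp
    ring
  rw [e]
  linarith
end
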